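/- Let H be a complex Hilbert space, let T be an invertible bounded linear operator on H with T² = I, let J be a conjugation on H with JT = TJ, and let U be the unitary factor in the polar decomposition T = U|T|. Set 𝒥 := J∘U. Then T is 𝒥-symmetric: T*∘𝒥 = 𝒥∘T, equivalently T = 𝒥∘T*∘𝒥. -/

import Mathlib

open ContinuousLinearMap in
/-- Positive square roots of bounded operators are unique. -/
theorem ContinuousLinearMap.IsPositive.eq_of_mul_self_eq {H : Type*} [NormedAddCommGroup H]
    [InnerProductSpace ℂ H] [CompleteSpace H] {A B : H →L[ℂ] H}
    (hA : A.IsPositive) (hB : B.IsPositive) (h : A * A = B * B) : A = B := by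
  rw [← nonneg_iff_isPositive] at hA hB
  exact (CFC.mul_self_eq_mul_self_iff A B hA hB).1 h

/-- A conjugation conjugates inner products. -/
theorem inner_conjugation {H : Type*} [NormedAddCommGroup H] [InnerProductSpace ℂ H]
    {J : H → H} (hJ_add : ∀ x y, J (x + y) = J x + J y)
    (hJ_smul : ∀ (c : ℂ) (x : H), J (c • x) = (starRingEnd ℂ c) • J x)
    (hJ_iso : ∀ x, ‖J x‖ = ‖x‖) (x y : H) :
    inner ℂ (J x) (J y) = inner ℂ y x := by
  have hsub (c : ℂ) : ‖J x + c • J y‖ = ‖x + (starRingEnd ℂ c) • y‖ := by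
    rw [← hJ_iso (x + _), hJ_add, hJ_smul, Complex.conj_conj]
  have h1 := hsub 1
  have h2 := hsub (-1)
  have h3 := hsub Complex.I
  have h4 := hsub (-Complex.I)
  simp only [map_neg, map_one, Complex.conj_I, neg_neg, one_smul, neg_smul,
    ← sub_eq_add_neg] at h1 h2 h3 h4
  rw [← inner_conj_symm y x, inner_eq_sum_norm_sq_div_four (J x), inner_eq_sum_norm_sq_div_four x]
  simp only [RCLike.I_to_complex, Complex.coe_algebraMap, h1, h2, h3, h4]
  simp [map_ofNat (starRingEnd ℂ) 4]
  ring

/-- The adjoint of an operator commuting with a conjugation commutes with it. -/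
theorem adjoint_conjugation_comm {H : Type*} [NormedAddCommGroup H] [InnerProductSpace ℂ H]
    [CompleteSpace H] {J : H → H} (hJ_add : ∀ x y, J (x + y) = J x + J y)
    (hJ_smul : ∀ (c : ℂ) (x : H), J (c • x) = (starRingEnd ℂ c) • J x)
    (hJ_iso : ∀ x, ‖J x‖ = ‖x‖) (hJ_inv : ∀ x, J (J x) = x)
    {T : H →L[ℂ] H} (hcomm : ∀ x, J (T x) = T (J x)) (x : H) :
    J (ContinuousLinearMap.adjoint T x) = ContinuousLinearMap.adjoint T (J x) := by
  have hinner := inner_conjugation hJ_add hJ_smul hJ_iso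
  refine ext_inner_right ℂ fun y => ?_
  rw [ContinuousLinearMap.adjoint_inner_left, ← hJ_inv y, ← hcomm, hinner, hinner,
    ContinuousLinearMap.adjoint_inner_right]

/-- A positive operator whose square commutes with a conjugation commutes with it. -/
theorem ContinuousLinearMap.IsPositive.conjugation_comm {H : Type*} [NormedAddCommGroup H]
    [InnerProductSpace ℂ H] [CompleteSpace H] {J : H → H}
    (hJ_add : ∀ x y, J (x + y) = J x + J y)
    (hJ_smul : ∀ (c : ℂ) (x : H), J (c • x) = (starRingEnd ℂ c) • J x)
    (hJ_iso : ∀ x, ‖J x‖ = ‖x‖) (hJ_inv : ∀ x, J (J x) = x)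
    {A : H →L[ℂ] H} (hA : A.IsPositive) (hcomm : ∀ x, J (A (A x)) = A (A (J x))) (x : H) :
    J (A x) = A (J x) := by
  have hinner := inner_conjugation hJ_add hJ_smul hJ_iso
  let B : H →L[ℂ] H := LinearMap.mkContinuous
    { toFun := fun x => J (A (J x))
      map_add' := fun x y => by simp only [hJ_add, map_add]
      map_smul' := fun c x => by simp only [hJ_smul, map_smul, Complex.conj_conj, RingHom.id_apply] }
    ‖A‖ fun x => by
      change ‖J (A (J x))‖ ≤ _
      rw [hJ_iso, ← hJ_iso x]
      exact A.le_opNorm _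
  have hB_apply (x : H) : B x = J (A (J x)) := rfl
  have hB : B.IsPositive := by
    rw [ContinuousLinearMap.isPositive_iff_complex]
    intro x
    have h : inner ℂ (B x) x = inner ℂ (J x) (A (J x)) := by
      rw [hB_apply]
      conv_lhs => rw [← hJ_inv x]
      rw [hinner, hJ_inv]
    have h' := (ContinuousLinearMap.isPositive_iff_complex A).1 hA (J x)
    rw [h, ← hA.inner_left_eq_inner_right]
    exact h'
  have hBA : B = A := hB.eq_of_mul_self_eq hA <| by
    ext x
    simp only [mul_apply_eq_comp, hB_apply, hJ_inv, hcomm]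
  rw [← hJ_inv x, ← hB_apply, hBA, hJ_inv]

/-- Let `T` be an invertible bounded operator on a complex Hilbert space
with `T² = I` (the hypothesis `T * T = 1` makes `T` invertible), let `J` be a conjugation
with `J T = T J`, and let `U` be the unitary factor in the polar decomposition
`T = U |T|`, where `absT = |T|` is the unique positive square root of `T*T`.
Set `𝒥 := J ∘ U`.  Then `T` is `𝒥`-symmetric: `T* ∘ 𝒥 = 𝒥 ∘ T`, equivalently
`T = 𝒥 ∘ T* ∘ 𝒥`. -/
theorem stmt_9 {H : Type*} [NormedAddCommGroup H] [InnerProductSpace ℂ H] [CompleteSpace H]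
    (J : H → H) (T U absT : H →L[ℂ] H)
    (hT : T * T = 1)
    (hJ_add : ∀ x y, J (x + y) = J x + J y)
    (hJ_smul : ∀ (c : ℂ) (x : H), J (c • x) = (starRingEnd ℂ c) • J x)
    (hJ_iso : ∀ x, ‖J x‖ = ‖x‖)
    (hJ_inv : ∀ x, J (J x) = x)
    (hcomm : ∀ x, J (T x) = T (J x))
    (habs_pos : absT.IsPositive)
    (habs_sq : absT * absT = ContinuousLinearMap.adjoint T * T)
    (hU : T = U * absT) :
    (∀ x, ContinuousLinearMap.adjoint T (J (U x)) = J (U (T x))) ∧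
      (∀ x, T x = J (U (ContinuousLinearMap.adjoint T (J (U x))))) := by
  have hTs : star T * star T = 1 := by rw [← star_mul, hT, star_one]
  rw [← ContinuousLinearMap.star_eq_adjoint] at habs_sq ⊢
  have hA : star absT = absT := habs_pos.isSelfAdjoint
  obtain ⟨B, hBA, hAB⟩ : ∃ B, B * absT = 1 ∧ absT * B = 1 := by
    have hl : T * star T * absT * absT = 1 := by
      rw [mul_assoc _ absT, habs_sq, mul_assoc, ← mul_assoc (star T), hTs, one_mul, hT]
    have hr : absT * (absT * (T * star T)) = 1 := by
      rw [← mul_assoc, habs_sq, mul_assoc, ← mul_assoc T, hT, one_mul, hTs]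
    exact ⟨_, hl, by rwa [left_inv_eq_right_inv hl hr]⟩
  have hBs : star B = B := left_inv_eq_right_inv
    (by rw [← hA, ← star_mul, hAB, star_one]) hAB
  have hUB : U = T * B := by rw [hU, mul_assoc, hAB, mul_one]
  have hBB : B * B = T * star T := left_inv_eq_right_inv (a := absT * absT)
    (by rw [mul_assoc, ← mul_assoc B absT, hBA, one_mul, hBA])
    (by rw [habs_sq, mul_assoc, ← mul_assoc T, hT, one_mul, hTs])
  have hB : B.IsPositive := by
    have h := habs_pos.conj_adjoint B
    rw [← ContinuousLinearMap.star_eq_adjoint, hBs] at h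
    change (B * (absT * B)).IsPositive at h
    rwa [hAB, mul_one] at h
  have hTBT : T * B * star T = B := by
    refine ContinuousLinearMap.IsPositive.eq_of_mul_self_eq (hB.conj_adjoint T) hB ?_
    calc T * B * star T * (T * B * star T)
        = T * B * (star T * T) * B * star T := by simp only [mul_assoc]
      _ = T * (B * absT) * (absT * B) * star T := by rw [← habs_sq]; simp only [mul_assoc]
      _ = B * B := by rw [hBA, hAB, hBB, mul_one, mul_one]
  have hUB' : U = B * star T := by
    rw [hUB, ← hTBT, mul_assoc _ (star T), hTs, mul_one, hTBT]
  have hTsU : star T * U = absT := by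
    rw [hUB, ← mul_assoc, ← habs_sq, mul_assoc, hAB, mul_one]
  have hUT : U * T = absT := by
    rw [hUB', mul_assoc, ← habs_sq, ← mul_assoc, hBA, one_mul]
  have hUU : U * U = 1 := by
    calc U * U = B * (star T * U) := by rw [← mul_assoc, ← hUB']
      _ = 1 := by rw [hTsU, hBA]
  have hJTs (x : H) : J (star T x) = star T (J x) :=
    adjoint_conjugation_comm hJ_add hJ_smul hJ_iso hJ_inv hcomm x
  have hJA := habs_pos.conjugation_comm hJ_add hJ_smul hJ_iso hJ_inv fun x => by
    simp only [← mul_apply_eq_comp, habs_sq]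
    simp only [mul_apply_eq_comp, hJTs, hcomm]
  have hJU (x : H) : J (U x) = U (J x) := by
    have hx : x = absT (B x) := by rw [← mul_apply_eq_comp, hAB]; rfl
    rw [hx, hJA, ← mul_apply_eq_comp U, ← mul_apply_eq_comp U, ← hU, hcomm]
  have hsymm (x : H) : star T (J (U x)) = J (U (T x)) := by
    rw [← hJTs, ← mul_apply_eq_comp, hTsU, ← hUT, mul_apply_eq_comp]
  refine ⟨hsymm, fun x => ?_⟩
  rw [hsymm, hJU (T x), ← mul_apply_eq_comp U U, hUU,
    one_apply_eq_self, hJ_inv]
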